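/- Suppose l and h are periodic with period L > 0, l(0) ≠ 0, and 1 − cos η(L) ≠ 0. If y(L) = y(0), y'(L) = y'(0) and x'(L) = x'(0), then necessarily c₁ = (F(L) − F(L)·cos η(L) + G(L)·sin η(L))/(2(1 − cos η(L))) and c₂ = (G(L) − G(L)·cos η(L) − F(L)·sin η(L))/(2(1 − cos η(L))). -/

import Mathlib

open Real

/-- The derivative of a function given as the integral of a continuous function. -/
lemma hasDerivAt_of_eq_integral {f g : ℝ → ℝ} (hg : Continuous g)
    (hf : ∀ t, f t = ∫ u in (0:ℝ)..t, g u) (t : ℝ) : HasDerivAt f (g t) t := by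
  rw [funext hf]
  exact hg.integral_hasStrictDerivAt 0 t |>.hasDerivAt

/-- A rotation by an angle `θ` with `cos θ ≠ 1`, followed by a translation, has its fixed point
determined by the translation. -/
lemma center_eq_of_rotation {s c f g c₁ c₂ : ℝ} (hsc : s ^ 2 + c ^ 2 = 1) (hc : 1 - c ≠ 0)
    (h₁ : s * (f - c₁) + c * (g - c₂) = -c₂) (h₂ : s * (g - c₂) - c * (f - c₁) = c₁) :
    c₁ = (f - f * c + g * s) / (2 * (1 - c)) ∧ c₂ = (g - g * c - f * s) / (2 * (1 - c)) := by
  have hf : f = (1 - c) * c₁ - s * c₂ := by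
    linear_combination s * h₁ - c * h₂ - (f - c₁) * hsc
  have hg : g = (1 - c) * c₂ + s * c₁ := by
    linear_combination c * h₁ + s * h₂ - (g - c₂) * hsc
  have h2 : 2 * (1 - c) ≠ 0 := mul_ne_zero two_ne_zero hc
  constructor
  · rw [eq_div_iff h2]
    linear_combination -(1 - c) * hf - s * hg - c₁ * hsc
  · rw [eq_div_iff h2]
    linear_combination -(1 - c) * hg + s * hf - c₂ * hsc

/-- Necessity of the values of `c₁, c₂` for periodicity in the generic case
`1 − cos η(L) ≠ 0`. -/
theorem necessity_of_constants_generic_case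
    (l h : ℝ → ℝ) (hl : ContDiff ℝ (⊤ : ℕ∞) l) (hh : ContDiff ℝ (⊤ : ℕ∞) h)
    (η F G : ℝ → ℝ)
    (hη : ∀ u, η u = ∫ v in (0:ℝ)..u, 2 * h v)
    (hF : ∀ t, F t = ∫ u in (0:ℝ)..t, l u * sin (η u))
    (hG : ∀ t, G t = ∫ u in (0:ℝ)..t, l u * cos (η u))
    (c₁ c₂ : ℝ)
    (hpos : ∀ t, 0 < (F t - c₁) ^ 2 + (G t - c₂) ^ 2)
    (y x : ℝ → ℝ)
    (hy : ∀ t, y t = Real.sqrt ((F t - c₁) ^ 2 + (G t - c₂) ^ 2))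
    (hx : ∀ t, x t = ∫ u in (0:ℝ)..t,
      (deriv F u * (G u - c₂) - deriv G u * (F u - c₁)) / y u)
    (L : ℝ) (hL : 0 < L)
    (hlper : ∀ t, l (t + L) = l t) (hhper : ∀ t, h (t + L) = h t)
    (hl0 : l 0 ≠ 0)
    (hcos : 1 - cos (η L) ≠ 0)
    (hyL : y L = y 0) (hy'L : deriv y L = deriv y 0) (hx'L : deriv x L = deriv x 0) :
    c₁ = (F L - F L * cos (η L) + G L * sin (η L)) / (2 * (1 - cos (η L))) ∧
    c₂ = (G L - G L * cos (η L) - F L * sin (η L)) / (2 * (1 - cos (η L))) := by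
  have hηd := hasDerivAt_of_eq_integral (continuous_const.mul hh.continuous) hη
  have hηc : Continuous η := continuous_iff_continuousAt.2 fun t => (hηd t).continuousAt
  have hFd : ∀ t, HasDerivAt F (l t * sin (η t)) t :=
    hasDerivAt_of_eq_integral (hl.continuous.mul (continuous_sin.comp hηc)) hF
  have hGd : ∀ t, HasDerivAt G (l t * cos (η t)) t :=
    hasDerivAt_of_eq_integral (hl.continuous.mul (continuous_cos.comp hηc)) hG
  have hFc : Continuous F := continuous_iff_continuousAt.2 fun t => (hFd t).continuousAt
  have hGc : Continuous G := continuous_iff_continuousAt.2 fun t => (hGd t).continuousAt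
  have hy0 : ∀ t, 0 < y t := fun t => by rw [hy]; exact Real.sqrt_pos.2 (hpos t)
  have hyc : Continuous y := by
    rw [funext hy]
    fun_prop
  have hyd : ∀ t, deriv y t =
      l t * (sin (η t) * (F t - c₁) + cos (η t) * (G t - c₂)) / y t := fun t => by
    have hd := ((((hFd t).sub_const c₁).pow 2).add (((hGd t).sub_const c₂).pow 2)).sqrt
      (hpos t).ne'
    rw [funext hy]
    refine hd.deriv.trans ?_
    simp only [Pi.add_apply, Pi.pow_apply]
    rw [← hy t]
    have hyt := (hy0 t).ne'
    field_simp
    ring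
  have hxd : ∀ t, deriv x t =
      l t * (sin (η t) * (G t - c₂) - cos (η t) * (F t - c₁)) / y t := fun t => by
    have hc : Continuous fun u =>
        l u * (sin (η u) * (G u - c₂) - cos (η u) * (F u - c₁)) / y u := by
      have hlc := hl.continuous
      exact Continuous.div (by fun_prop) hyc fun u => (hy0 u).ne'
    refine (hasDerivAt_of_eq_integral hc (fun t => ?_) t).deriv
    rw [hx]
    congr 1
    ext u
    rw [(hFd u).deriv, (hGd u).deriv]
    ring
  have hη0 : η 0 = 0 := by simp [hη]
  have hF0 : F 0 = 0 := by simp [hF]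
  have hG0 : G 0 = 0 := by simp [hG]
  have hlL : l L = l 0 := by simpa using hlper 0
  rw [hyd, hyd, hyL, hlL, div_left_inj' (hy0 0).ne', mul_right_inj' hl0] at hy'L
  rw [hxd, hxd, hyL, hlL, div_left_inj' (hy0 0).ne', mul_right_inj' hl0] at hx'L
  simp only [hη0, hF0, hG0, sin_zero, cos_zero] at hy'L hx'L
  exact center_eq_of_rotation (sin_sq_add_cos_sq (η L)) hcos (by linarith) (by linarith)
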